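/- Let f₁,…,f_k be homeomorphisms of the circle S¹. Then the following are equivalent: (i) there exists ω ∈ Ω such that O⁺_ω(x) is dense in S¹ for every x ∈ S¹; (ii) for every disjunctive sequence ω ∈ Ω and every x ∈ S¹, O⁺_ω(x) is dense in S¹; (iii) the IFS generated by f₁,…,f_k is both forward minimal and backward minimal. -/

import Mathlib

open Set Filter Topology

/-- The Hutchinson operator of the IFS generated by `f 0, …, f (k-1)`. -/
def Hutch {X : Type*} {k : ℕ} (f : Fin k → X → X) (S : Set X) : Set X :=
  ⋃ i, f i '' S

/-- The semigroup generated by the maps `f 0, …, f (k-1)`: all finite (nonempty)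
compositions. -/
def IFSsemigroup {X : Type*} {k : ℕ} (f : Fin k → X → X) : Set (X → X) :=
  {g | ∃ l : List (Fin k), l ≠ [] ∧ g = (l.map f).foldr (· ∘ ·) id}

/-- The Γ-orbit of a point. -/
def GammaOrbit {X : Type*} {k : ℕ} (f : Fin k → X → X) (x : X) : Set X :=
  {y | ∃ g ∈ IFSsemigroup f, g x = y}

/-- Convergence of a sequence of sets to a compact set `L` in the Vietoris sense. -/
def VTendsto {X : Type*} [TopologicalSpace X] (A : ℕ → Set X) (L : Set X) : Prop :=
  ∀ U V : Set X, IsOpen U → L ⊆ U → IsOpen V → (V ∩ L).Nonempty →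
    ∃ n₀ : ℕ, ∀ n ≥ n₀, A n ⊆ U ∧ (A n ∩ V).Nonempty

/-- The pointwise basin of a compact set `A`. -/
def BasinP {X : Type*} [TopologicalSpace X] {k : ℕ} (f : Fin k → X → X) (A : Set X) :
    Set X :=
  {x | VTendsto (fun n => (Hutch f)^[n] {x}) A}

/-- `A` is a pointwise attractor. -/
def IsPointwiseAttractor {X : Type*} [TopologicalSpace X] {k : ℕ}
    (f : Fin k → X → X) (A : Set X) : Prop :=
  IsCompact A ∧ A.Nonempty ∧ ∃ U : Set X, IsOpen U ∧ A ⊆ U ∧ U ⊆ BasinP f A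

/-- `A` is a strict attractor. -/
def IsStrictAttractor {X : Type*} [TopologicalSpace X] {k : ℕ}
    (f : Fin k → X → X) (A : Set X) : Prop :=
  IsCompact A ∧ A.Nonempty ∧ ∃ U : Set X, IsOpen U ∧ A ⊆ U ∧
    ∀ K : Set X, K.Nonempty → IsCompact K → K ⊆ U →
      VTendsto (fun n => (Hutch f)^[n] K) A

/-- The basin of a strict attractor: the union of all open neighborhoods witnessing
the attraction. -/
def BasinS {X : Type*} [TopologicalSpace X] {k : ℕ} (f : Fin k → X → X) (A : Set X) :
    Set X :=
  ⋃₀ {U : Set X | IsOpen U ∧ A ⊆ U ∧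
    ∀ K : Set X, K.Nonempty → IsCompact K → K ⊆ U →
      VTendsto (fun n => (Hutch f)^[n] K) A}

/-- `f_ω^n = f_{ω n-1} ∘ ⋯ ∘ f_{ω 0}` (the orbital branch corresponding to `ω`). -/
def FibIter {X : Type*} {k : ℕ} (f : Fin k → X → X) (ω : ℕ → Fin k) : ℕ → X → X
  | 0 => id
  | n + 1 => f (ω n) ∘ FibIter f ω n

/-- The tail `{f_ω^m x : m ≥ n}` of the ω-fiberwise orbit of `x`. -/
def TailOrbit {X : Type*} {k : ℕ} (f : Fin k → X → X) (ω : ℕ → Fin k) (x : X) (n : ℕ) :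
    Set X :=
  {y | ∃ m ≥ n, FibIter f ω m x = y}

/-- The ω-fiberwise orbit `O⁺_ω(x) = {f_ω^n x : n ≥ 1}`. -/
def Oplus {X : Type*} {k : ℕ} (f : Fin k → X → X) (ω : ℕ → Fin k) (x : X) : Set X :=
  TailOrbit f ω x 1

/-- The shift map on `Ω = {1,…,k}^ℕ`. -/
def shiftSeq {k : ℕ} (ω : ℕ → Fin k) : ℕ → Fin k := fun n => ω (n + 1)

/-- A sequence is disjunctive if its orbit under the shift is dense in
`Ω = {1,…,k}^ℕ` (with the product topology). -/
def Disjunctive {k : ℕ} (ω : ℕ → Fin k) : Prop :=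
  Dense (Set.range fun n => shiftSeq^[n] ω)

/-- The IFS is forward minimal on the whole space. -/
def ForwardMinimal {X : Type*} [TopologicalSpace X] {k : ℕ} (f : Fin k → X → X) : Prop :=
  ∀ B : Set X, B.Nonempty → IsClosed B → (∀ i, f i '' B ⊆ B) → B = Set.univ

/-- The IFS is backward minimal on the whole space. -/
def BackwardMinimal {X : Type*} [TopologicalSpace X] {k : ℕ} (f : Fin k → X → X) : Prop :=
  ∀ B : Set X, B.Nonempty → IsClosed B →
    (∀ g ∈ IFSsemigroup f, (g ⁻¹' B).Nonempty ∧ g ⁻¹' B ⊆ B) → B = Set.univ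

/-- The attractor `A` is contractible. -/
def ContractibleAttractor {X : Type*} [TopologicalSpace X] {k : ℕ}
    (f : Fin k → X → X) (A : Set X) : Prop :=
  ∀ K : Set X, K ⊆ A → IsCompact K → K ≠ A →
    ∀ 𝒰 : Set (Set X), (∀ U ∈ 𝒰, IsOpen U) → A ⊆ ⋃₀ 𝒰 →
      ∃ g ∈ IFSsemigroup f, ∃ U ∈ 𝒰, g '' K ⊆ U

/-- `f_{ω 0} ∘ ⋯ ∘ f_{ω (n-1)}` (compositions in the reverse order). -/
def FibDown {X : Type*} {k : ℕ} (f : Fin k → X → X) (ω : ℕ → Fin k) : ℕ → X → X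
  | 0 => id
  | n + 1 => FibDown f ω n ∘ f (ω n)

/-- The attractor `A` is strongly-fibred. -/
def StronglyFibred {X : Type*} [TopologicalSpace X] {k : ℕ}
    (f : Fin k → X → X) (A : Set X) : Prop :=
  ∀ U : Set X, IsOpen U → (U ∩ A).Nonempty →
    ∃ ω : ℕ → Fin k, (⋂ n, FibDown f ω n '' A) ⊆ U


namespace CG

def run {X : Type*} {k : ℕ} (f : Fin k → X → X) : List (Fin k) → X → X
  | [], x => x
  | i :: w, x => run f w (f i x)

def Hit {X : Type*} {k : ℕ} (f : Fin k → X → X) (I : Set X) : List (Fin k) → X → Prop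
  | [], _ => False
  | i :: w, x => f i x ∈ I ∨ Hit f I w (f i x)

section basic
variable {X : Type*} {k : ℕ} (f : Fin k → X → X) (I : Set X)

lemma run_append (u v : List (Fin k)) (x : X) : run f (u ++ v) x = run f v (run f u x) := by
  induction u generalizing x with
  | nil => rfl
  | cons i u ih => simp [run, ih]

lemma hit_append (u v : List (Fin k)) (x : X) :
    Hit f I (u ++ v) x ↔ Hit f I u x ∨ Hit f I v (run f u x) := by
  induction u generalizing x with
  | nil => simp [Hit, run]
  | cons i u ih => simp [Hit, run, ih, or_assoc]

lemma run_bij (hf : ∀ i, Function.Bijective (f i)) (w : List (Fin k)) :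
    Function.Bijective (run f w) := by
  induction w with
  | nil => exact Function.bijective_id
  | cons i w ih => exact ih.comp (hf i)

variable [TopologicalSpace X]

lemma run_homeo (hf : ∀ i, IsHomeomorph (f i)) (w : List (Fin k)) : IsHomeomorph (run f w) := by
  induction w with
  | nil => exact (Homeomorph.refl X).isHomeomorph
  | cons i w ih => exact ih.comp (hf i)

lemma hit_open (hf : ∀ i, IsHomeomorph (f i)) (hI : IsOpen I) (w : List (Fin k)) :
    IsOpen {x | Hit f I w x} := by
  induction w with
  | nil => simp [Hit]
  | cons i w ih =>
    exact (hI.preimage (hf i).continuous).union (ih.preimage (hf i).continuous)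

end basic

/-- One step of the averaging operator on set functions. -/
noncomputable def avg {X : Type*} {k : ℕ} (f : Fin k → X → X) (L : Set X → ℝ) : Set X → ℝ :=
  fun A => (∑ i, L (f i '' A)) / k

structure Good {X : Type*} (L : Set X → ℝ) : Prop where
  nonneg : ∀ A, 0 ≤ L A
  univ : L Set.univ = 1
  add : ∀ A B, Disjoint A B → L (A ∪ B) = L A + L B

lemma Good.mono {X : Type*} {L : Set X → ℝ} (h : Good L) {A B : Set X} (hAB : A ⊆ B) :
    L A ≤ L B := by
  have := h.add A (B \ A) Set.disjoint_sdiff_right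
  rw [Set.union_sdiff_cancel hAB] at this
  linarith [h.nonneg (B \ A)]

lemma Good.empty {X : Type*} {L : Set X → ℝ} (h : Good L) : L ∅ = 0 := by
  have := h.add ∅ ∅ (by simp)
  simp at this; exact this

lemma Good.le_one {X : Type*} {L : Set X → ℝ} (h : Good L) (A : Set X) : L A ≤ 1 :=
  h.univ ▸ h.mono (Set.subset_univ A)

lemma Good.union_le {X : Type*} {L : Set X → ℝ} (h : Good L) (A B : Set X) :
    L (A ∪ B) ≤ L A + L B := by
  have := h.add A (B \ A) Set.disjoint_sdiff_right
  rw [Set.union_sdiff_self] at this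
  linarith [h.mono (Set.sdiff_subset : B \ A ⊆ B)]

lemma Good.biUnion_le {X ι : Type*} {L : Set X → ℝ} (h : Good L) (s : Finset ι) (A : ι → Set X) :
    L (⋃ i ∈ s, A i) ≤ ∑ i ∈ s, L (A i) := by
  classical
  induction s using Finset.induction_on with
  | empty => simp [h.empty]
  | insert a s ha ih =>
    rw [Finset.set_biUnion_insert, Finset.sum_insert ha]
    linarith [h.union_le (A a) (⋃ i ∈ s, A i)]

lemma Good.sum_eq {X ι : Type*} {L : Set X → ℝ} (h : Good L) (s : Finset ι) (A : ι → Set X)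
    (hd : Pairwise (Function.onFun Disjoint A)) :
    ∑ i ∈ s, L (A i) = L (⋃ i ∈ s, A i) := by
  classical
  induction s using Finset.induction_on with
  | empty => simp [h.empty]
  | insert a s ha ih =>
    rw [Finset.set_biUnion_insert, Finset.sum_insert ha, ih, h.add]
    simp only [Set.disjoint_iUnion_right]
    intro i hi
    exact hd (by rintro rfl; exact ha hi)

lemma Good.avg {X : Type*} {k : ℕ} (hk : 0 < k) {f : Fin k → X → X}
    (hf : ∀ i, Function.Bijective (f i)) {L : Set X → ℝ} (h : Good L) : Good (avg f L) where
  nonneg A := div_nonneg (Finset.sum_nonneg fun i _ => h.nonneg _) (by positivity)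
  univ := by
    have : (k : ℝ) ≠ 0 := by positivity
    simp [CG.avg, Set.image_univ, (hf _).2.range_eq, h.univ, this]
  add A B hAB := by
    have : ∀ i, L (f i '' (A ∪ B)) = L (f i '' A) + L (f i '' B) := fun i => by
      rw [Set.image_union, h.add]
      exact (Set.disjoint_image_iff (hf i).1).2 hAB
    simp [CG.avg, this, Finset.sum_add_distrib, add_div]

lemma exists_lam {X : Type*} {k : ℕ} (hk : 0 < k) (f : Fin k → X → X)
    (hf : ∀ i, Function.Bijective (f i)) (z : X) :
    ∃ L : Set X → ℝ, Good L ∧ ∀ A, ∑ i, L (f i '' A) = k * L A := by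
  classical
  have hk0 : (k : ℝ) ≠ 0 := by positivity
  let L0 : Set X → ℝ := fun A => if z ∈ A then 1 else 0
  have h0 : Good L0 := by
    refine ⟨fun A => ?_, by simp [L0], fun A B hAB => ?_⟩
    · simp only [L0]; split_ifs <;> norm_num
    · have := fun h : z ∈ A => Set.disjoint_left.1 hAB h
      by_cases h1 : z ∈ A <;> by_cases h2 : z ∈ B <;> simp_all [L0]
  let P : ℕ → Set X → ℝ := fun n => (avg f)^[n] L0
  have hP : ∀ n, Good (P n) := by
    intro n
    induction n with
    | zero => exact h0
    | succ n ih =>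
      simp only [P, Function.iterate_succ_apply'] at ih ⊢
      exact ih.avg hk hf
  have hPs : ∀ n A, ∑ i, P n (f i '' A) = k * P (n+1) A := by
    intro n A
    simp only [P, Function.iterate_succ_apply']
    simp only [avg]; field_simp
  let c : ℕ → Set X → ℝ := fun n A => (∑ j ∈ Finset.range (n+1), P j A) / (n+1)
  have hc : ∀ n, Good (c n) := by
    intro n
    have : (n : ℝ) + 1 ≠ 0 := by positivity
    refine ⟨fun A => div_nonneg (Finset.sum_nonneg fun i _ => (hP i).nonneg _) (by positivity),
      ?_, fun A B hAB => ?_⟩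
    · simp [c, (hP _).univ, this]
    · simp [c, (hP _).add A B hAB, Finset.sum_add_distrib, add_div]
  let F : Ultrafilter ℕ := Filter.hyperfilter ℕ
  have hF : (F : Filter ℕ) ≤ Filter.atTop := by
    rw [← Nat.cofinite_eq_atTop]; exact Filter.hyperfilter_le_cofinite
  have hlim : ∀ A, ∃ l : ℝ, Filter.Tendsto (fun n => c n A) F (𝓝 l) := by
    intro A
    obtain ⟨l, -, hl⟩ := (isCompact_Icc (a := (0:ℝ)) (b := 1)).ultrafilter_le_nhds
      (F.map (fun n => c n A)) (by
        rw [Filter.le_principal_iff]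
        exact Ultrafilter.mem_map.2 (Filter.Eventually.of_forall fun n => ⟨(hc n).nonneg A, (hc n).le_one A⟩))
    exact ⟨l, hl⟩
  choose L hL using hlim
  refine ⟨L, ⟨fun A => ge_of_tendsto' (hL A) fun n => (hc n).nonneg A, ?_, fun A B hAB => ?_⟩,
    fun A => ?_⟩
  · refine tendsto_nhds_unique (hL Set.univ) ?_
    simp only [(hc _).univ]; exact tendsto_const_nhds
  · refine tendsto_nhds_unique (hL (A ∪ B)) ?_
    simp only [(hc _).add A B hAB]; exact (hL A).add (hL B)
  · have h1 : Filter.Tendsto (fun n => ∑ i, c n (f i '' A)) F (𝓝 (∑ i, L (f i '' A))) :=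
      tendsto_finsetSum _ fun i _ => hL _
    have h2 : ∀ n : ℕ, ∑ i, c n (f i '' A) =
        k * c n A + k * (P (n+1) A - P 0 A) / (n+1) := by
      intro n
      simp only [c]
      rw [← Finset.sum_div, Finset.sum_comm]
      simp only [hPs]
      rw [← Finset.mul_sum]
      have := Finset.sum_range_succ' (fun j => P j A) (n+1)
      rw [Finset.sum_range_succ] at this
      have h3 : ∑ j ∈ Finset.range (n+1), P (j+1) A =
        ∑ j ∈ Finset.range (n+1), P j A + (P (n+1) A - P 0 A) := by linarith
      rw [h3]; ring
    have h3 : Filter.Tendsto (fun n : ℕ => k * (P (n+1) A - P 0 A) / ((n:ℝ)+1)) F (𝓝 0) := by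
      refine Filter.Tendsto.mono_left ?_ hF
      have h4 : Filter.Tendsto (fun n : ℕ => (k:ℝ) / ((n:ℝ)+1)) Filter.atTop (𝓝 0) := by
        have := (tendsto_one_div_add_atTop_nhds_zero_nat (𝕜 := ℝ)).const_mul (k:ℝ)
        simpa [div_eq_mul_inv] using this
      refine squeeze_zero_norm (fun n => ?_) h4
      rw [norm_div, norm_mul]
      have e1 : ‖(P (n+1) A - P 0 A)‖ ≤ 1 := by
        rw [Real.norm_eq_abs, abs_le]
        constructor <;> linarith [(hP (n+1)).nonneg A, (hP 0).nonneg A, (hP (n+1)).le_one A,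
          (hP 0).le_one A]
      have e2 : ‖(n:ℝ)+1‖ = n+1 := by rw [Real.norm_of_nonneg]; positivity
      rw [e2, Real.norm_of_nonneg (by positivity : (0:ℝ) ≤ k)]
      gcongr
      nlinarith [norm_nonneg (P (n+1) A - P 0 A), (Nat.cast_nonneg k : (0:ℝ) ≤ k)]
    refine tendsto_nhds_unique h1 ?_
    simp only [h2]
    simpa using ((hL A).const_mul (k:ℝ)).add h3

/-- The combinatorial counting lemma. -/
lemma count {X ι : Type*} {k : ℕ} (hk : 0 < k) (f : Fin k → X → X) (I : Set X)
    (C : Set X → Prop) (hC : ∀ A i, C A → C (f i '' A))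
    (L : Set X → ℝ) (hL : ∀ A, 0 ≤ L A) (hLs : ∀ A, ∑ i, L (f i '' A) = k * L A)
    (ε : ℝ) (M : ℕ)
    (hkill : ∀ J, C J → L J < ε → ∃ v : List (Fin k), v.length ≤ M ∧ ∀ x ∈ J, Hit f I v x)
    (B : ℝ) : ∀ (N : ℕ) (S : Finset ι) (A : ι → Set X), S.card = N → (∀ j, C (A j)) →
      ∑ j ∈ S, L (A j) < B → ∃ w : List (Fin k), ∃ S' ⊆ S, ε * S'.card ≤ B ∧
        ∀ j ∈ S, j ∉ S' → ∀ x ∈ A j, Hit f I w x := by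
  classical
  intro N
  induction N with
  | zero =>
    intro S A hS _ hB
    rw [Finset.card_eq_zero] at hS
    subst hS
    exact ⟨[], ∅, by simp, by simpa using hB.le, by simp⟩
  | succ N ih =>
    by_contra hbad
    push Not at hbad
    let W : Finset ι → (ι → Set X) → Prop := fun S A => ∃ w : List (Fin k), ∃ S' ⊆ S,
      ε * S'.card ≤ B ∧ ∀ j ∈ S, j ∉ S' → ∀ x ∈ A j, Hit f I w x
    let Bad : Finset ι → (ι → Set X) → Prop := fun S A =>
      S.card = N + 1 ∧ (∀ j, C (A j)) ∧ ¬ W S A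
    let σ : Finset ι → (ι → Set X) → ℝ := fun S A => ∑ j ∈ S, L (A j)
    let T : Set ℝ := {t | ∃ S A, Bad S A ∧ σ S A = t}
    obtain ⟨S0, A0, hS0, hA0, hB0, hW0⟩ := hbad
    have hbad0 : Bad S0 A0 := ⟨hS0, hA0, by
      rintro ⟨w, S', h1, h2, h3⟩
      obtain ⟨j, a, b, x, c, d⟩ := hW0 w S' h1 h2
      exact d (h3 j a b x c)⟩
    have hTne : T.Nonempty := ⟨_, S0, A0, hbad0, rfl⟩
    have hTbdd : BddBelow T := ⟨0, by
      rintro _ ⟨S, A, -, rfl⟩; exact Finset.sum_nonneg fun j _ => hL _⟩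
    set s := sInf T
    have hsB : s < B := (csInf_le hTbdd ⟨S0, A0, hbad0, rfl⟩).trans_lt hB0
    have hsle : ∀ S A, Bad S A → s ≤ σ S A := fun S A h => csInf_le hTbdd ⟨S, A, h, rfl⟩
    have hk1 : (1:ℝ) ≤ k := by exact_mod_cast hk
    have hkM : (0:ℝ) < (k:ℝ)^M := by positivity
    have step : ∀ S A i, Bad S A → Bad S (fun j => f i '' A j) ∧
        σ S (fun j => f i '' A j) - s ≤ k * (σ S A - s) := by
      intro S A i h
      have hb : ∀ i, Bad S (fun j => f i '' A j) := by
        intro i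
        refine ⟨h.1, fun j => hC _ _ (h.2.1 j), ?_⟩
        rintro ⟨w, S', h1, h2, h3⟩
        refine h.2.2 ⟨i :: w, S', h1, h2, fun j hj hj' x hx => Or.inr (h3 j hj hj' _ ⟨x, hx, rfl⟩)⟩
      refine ⟨hb i, ?_⟩
      have e : ∑ i, (σ S (fun j => f i '' A j) - s) = k * (σ S A - s) := by
        rw [Finset.sum_sub_distrib]
        simp only [σ]
        rw [Finset.sum_comm]
        simp only [hLs]
        rw [← Finset.mul_sum]
        simp; ring
      rw [← e]
      exact Finset.single_le_sum (f := fun i => σ S (fun j => f i '' A j) - s)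
        (fun i _ => sub_nonneg.2 (hsle _ _ (hb i))) (Finset.mem_univ i)
    have steps : ∀ (v : List (Fin k)) S A, Bad S A → Bad S (fun j => run f v '' A j) ∧
        σ S (fun j => run f v '' A j) - s ≤ k^v.length * (σ S A - s) := by
      intro v
      induction v with
      | nil => intro S A h; simpa [run] using h
      | cons i v ihv =>
        intro S A h
        obtain ⟨h1, h2⟩ := step S A i h
        obtain ⟨h3, h4⟩ := ihv S _ h1
        have e : ∀ j, run f v '' (f i '' A j) = run f (i :: v) '' A j := by
          intro j; rw [Set.image_image]; rfl
        simp only [e] at h3 h4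
        refine ⟨h3, h4.trans ?_⟩
        rw [List.length_cons, pow_succ, mul_assoc]
        gcongr
    obtain ⟨_, ⟨S, A, hSA, rfl⟩, hlt⟩ := exists_lt_of_csInf_lt hTne
      (show s < s + (B - s) / k^M by have : 0 < (B - s) / k^M := div_pos (by linarith) hkM
                                     linarith)
    have hlt' : k^M * (σ S A - s) < B - s := by
      rw [← lt_div_iff₀' hkM]; linarith
    have hs0 : 0 ≤ σ S A - s := sub_nonneg.2 (hsle _ _ hSA)
    have hσB : σ S A < B := by nlinarith [one_le_pow₀ hk1 (n := M)]
    obtain ⟨j, hjS, hj⟩ : ∃ j ∈ S, L (A j) < ε := by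
      by_contra hcon
      push Not at hcon
      have : ε * S.card ≤ σ S A := by
        have := Finset.card_nsmul_le_sum S (fun j => L (A j)) ε hcon
        rw [nsmul_eq_mul] at this; simp only [σ]; linarith
      exact hSA.2.2 ⟨[], S, subset_rfl, by linarith, fun j h1 h2 => absurd h1 h2⟩
    obtain ⟨v, hvM, hv⟩ := hkill _ (hSA.2.1 j) hj
    obtain ⟨h3, h4⟩ := steps v S A hSA
    have h5 : σ S (fun j => run f v '' A j) < B := by
      have : (k:ℝ)^v.length ≤ k^M := pow_le_pow_right₀ hk1 hvM
      nlinarith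
    obtain ⟨w, S', h6, h7, h8⟩ := ih (S.erase j) (fun j => run f v '' A j)
      (by rw [Finset.card_erase_of_mem hjS, hSA.1]; rfl) h3.2.1
      (lt_of_le_of_lt (Finset.sum_le_sum_of_subset_of_nonneg (Finset.erase_subset _ _)
        fun _ _ _ => hL _) h5)
    refine hSA.2.2 ⟨v ++ w, S', h6.trans (Finset.erase_subset _ _), h7, fun l hl hl' x hx => ?_⟩
    rw [hit_append]
    by_cases hlj : l = j
    · subst hlj; exact Or.inl (hv x hx)
    · exact Or.inr (h8 l (Finset.mem_erase.2 ⟨hlj, hl⟩) hl' _ ⟨x, hx, rfl⟩)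

section top
variable {X : Type*} {k : ℕ} {f : Fin k → X → X} [TopologicalSpace X]

lemma fwd_hit (hk : 0 < k) (hf : ∀ i, IsHomeomorph (f i)) (hF : ForwardMinimal f)
    {I : Set X} (hI : IsOpen I) (hne : I.Nonempty) (x : X) : ∃ w, Hit f I w x := by
  by_contra hx
  push Not at hx
  let B : Set X := {x | ∀ w, ¬ Hit f I w x}
  have hB : B = Set.univ := by
    refine hF B ⟨x, hx⟩ ?_ ?_
    · have : B = ⋂ w, {x | Hit f I w x}ᶜ := by ext; simp [B]
      rw [this]
      exact isClosed_iInter fun w => (hit_open f I hf hI w).isClosed_compl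
    · rintro i _ ⟨y, hy, rfl⟩ w hw
      exact hy (i :: w) (Or.inr hw)
  obtain ⟨y, hy⟩ := hne
  obtain ⟨z, rfl⟩ := (hf ⟨0, hk⟩).surjective y
  exact (hB ▸ Set.mem_univ z : z ∈ B) [⟨0, hk⟩] (Or.inl hy)

lemma bwd_reach (hf : ∀ i, IsHomeomorph (f i)) (hB : BackwardMinimal f)
    {J : Set X} (hJ : IsOpen J) (hne : J.Nonempty) (q : X) :
    ∃ v, ∃ z ∈ J, run f v z = q := by
  by_contra hx
  push Not at hx
  let B : Set X := {q | ∀ v, ∀ z ∈ J, run f v z ≠ q}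
  have hstep : ∀ i x, f i x ∈ B → x ∈ B := by
    intro i x hx v z hz h
    refine hx (v ++ [i]) z hz ?_
    rw [run_append, h]; rfl
  have hBu : B = Set.univ := by
    refine hB B ⟨q, hx⟩ ?_ ?_
    · have : B = ⋂ v, (run f v '' J)ᶜ := by ext; simp [B]
      rw [this]
      exact isClosed_iInter fun w => ((run_homeo f hf w).isOpenMap _ hJ).isClosed_compl
    · rintro g ⟨l, -, rfl⟩
      constructor
      · have hs : Function.Surjective ((l.map f).foldr (· ∘ ·) id) := by
          induction l with
          | nil => exact Function.surjective_id
          | cons i l ih => exact (hf i).surjective.comp ih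
        obtain ⟨y, hy⟩ := hs q
        exact ⟨y, by rw [Set.mem_preimage, hy]; exact hx⟩
      · induction l with
        | nil => exact fun x hx => hx
        | cons i l ih => exact fun x hx => ih (hstep i _ hx)
  obtain ⟨y, hy⟩ := hne
  exact (hBu ▸ Set.mem_univ y : y ∈ B) [] y hy rfl

lemma lam_run {L : Set X → ℝ} (hG : Good L) (hLs : ∀ A, ∑ i, L (f i '' A) = k * L A)
    (w : List (Fin k)) (A : Set X) : L (run f w '' A) ≤ k ^ w.length * L A := by
  induction w generalizing A with
  | nil => simp [run]
  | cons i w ih =>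
    have e : run f w '' (f i '' A) = run f (i :: w) '' A := by rw [Set.image_image]; rfl
    rw [← e]
    refine (ih _).trans ?_
    rw [List.length_cons, pow_succ, mul_assoc, ← hLs]
    gcongr
    exact Finset.single_le_sum (f := fun i => L (f i '' A)) (fun i _ => hG.nonneg _)
      (Finset.mem_univ i)

lemma lam_pos [CompactSpace X] (hf : ∀ i, IsHomeomorph (f i)) (hB : BackwardMinimal f)
    {L : Set X → ℝ} (hG : Good L) (hLs : ∀ A, ∑ i, L (f i '' A) = k * L A)
    {J : Set X} (hJ : IsOpen J) (hne : J.Nonempty) : 0 < L J := by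
  refine lt_of_le_of_ne (hG.nonneg J) fun h0 => ?_
  obtain ⟨t, ht⟩ := isCompact_univ.elim_finite_subcover (fun v => run f v '' J)
    (fun v => (run_homeo f hf v).isOpenMap _ hJ) (fun q _ => by
      obtain ⟨v, z, hz, h⟩ := bwd_reach hf hB hJ hne q
      exact Set.mem_iUnion.2 ⟨v, z, hz, h⟩)
  have h1 := (hG.mono ht).trans (hG.biUnion_le t _)
  have h2 : ∑ v ∈ t, L (run f v '' J) ≤ 0 := Finset.sum_nonpos fun v _ => by
    have := lam_run hG hLs v J
    rwa [← h0, mul_zero] at this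
  linarith [hG.univ]

end top

lemma lam_ball {X : Type*} {k : ℕ} {f : Fin k → X → X} [MetricSpace X] [CompactSpace X]
    (hf : ∀ i, IsHomeomorph (f i)) (hB : BackwardMinimal f)
    {L : Set X → ℝ} (hG : Good L) (hLs : ∀ A, ∑ i, L (f i '' A) = k * L A)
    {ρ : ℝ} (hρ : 0 < ρ) : ∃ ε > 0, ∀ z, ε ≤ L (Metric.ball z ρ) := by
  obtain ⟨t, -, htf, ht⟩ := (isCompact_univ (X := X)).finite_cover_balls (half_pos hρ)
  rcases t.eq_empty_or_nonempty with rfl | hne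
  · refine ⟨1, one_pos, fun z => ?_⟩
    simpa using ht (Set.mem_univ z)
  obtain ⟨a, -, ha⟩ := Set.exists_min_image t (fun z => L (Metric.ball z (ρ/2))) htf hne
  refine ⟨_, lam_pos hf hB hG hLs Metric.isOpen_ball ⟨a, Metric.mem_ball_self (half_pos hρ)⟩,
    fun z => ?_⟩
  obtain ⟨b, hb, hz⟩ := Set.mem_iUnion₂.1 (ht (Set.mem_univ z))
  refine (ha b hb).trans (hG.mono (Metric.ball_subset_ball' ?_))
  rw [dist_comm]
  linarith [Metric.mem_ball.1 hz]

lemma uniform_hit {X : Type*} {k : ℕ} (hk : 0 < k) {f : Fin k → X → X} [MetricSpace X]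
    [CompactSpace X]
    (hf : ∀ i, IsHomeomorph (f i)) (hF : ForwardMinimal f)
    {I : Set X} (hI : IsOpen I) (hne : I.Nonempty) :
    ∃ r > 0, ∃ M : ℕ, ∀ x, ∃ w : List (Fin k), w.length ≤ M ∧ ∀ y ∈ Metric.ball x r, Hit f I w y := by
  obtain ⟨t, ht⟩ := isCompact_univ.elim_finite_subcover (fun w => {x | Hit f I w x})
    (hit_open f I hf hI) (fun x _ => Set.mem_iUnion.2 (fwd_hit hk hf hF hI hne x))
  obtain ⟨r, hr, h⟩ := lebesgue_number_lemma_of_metric (isCompact_univ (X := X))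
    (c := fun w : t => {x | Hit f I w.1 x}) (fun w => hit_open f I hf hI w) (fun x hx => by
      obtain ⟨w, hw, h⟩ := Set.mem_iUnion₂.1 (ht hx)
      exact Set.mem_iUnion.2 ⟨⟨w, hw⟩, h⟩)
  refine ⟨r, hr, t.sup List.length, fun x => ?_⟩
  obtain ⟨w, hw⟩ := h x (Set.mem_univ x)
  exact ⟨w.1, Finset.le_sup (f := List.length) w.2, hw⟩

/-- Points whose every run-`u` preimage has hit `I`. -/
lemma bwd_kill {X : Type*} {k : ℕ} (hk : 0 < k) {f : Fin k → X → X} [TopologicalSpace X]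
    (hf : ∀ i, IsHomeomorph (f i)) (hB : BackwardMinimal f)
    {I : Set X} (hI : IsOpen I) (hne : I.Nonempty) (s : List X) :
    ∃ u : List (Fin k), ∀ q ∈ s, q ∈ run f u '' {x | Hit f I u x} := by
  induction s with
  | nil => exact ⟨[], by simp⟩
  | cons q s ih =>
    obtain ⟨u, hu⟩ := ih
    obtain ⟨q', rfl⟩ := (run_homeo f hf u).surjective q
    obtain ⟨v, z, hz, rfl⟩ := bwd_reach hf hB hI hne q'
    obtain ⟨z, rfl⟩ := (hf ⟨0, hk⟩).surjective z
    refine ⟨(⟨0, hk⟩ :: v) ++ u, ?_⟩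
    intro p hp
    rcases List.mem_cons.1 hp with rfl | hp
    · refine ⟨z, ?_, by rw [run_append]; rfl⟩
      exact (hit_append _ _ _ _ _).2 (Or.inl (Or.inl hz))
    · obtain ⟨y, hy, rfl⟩ := hu p hp
      obtain ⟨y, rfl⟩ := (run_homeo f hf (⟨0, hk⟩ :: v)).surjective y
      exact ⟨y, (hit_append _ _ _ _ _).2 (Or.inr hy), by rw [run_append]⟩

lemma bwd_uniform {X : Type*} {k : ℕ} (hk : 0 < k) {f : Fin k → X → X} [MetricSpace X]
    [CompactSpace X]
    (hf : ∀ i, IsHomeomorph (f i)) (hB : BackwardMinimal f)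
    {I : Set X} (hI : IsOpen I) (hne : I.Nonempty) (m : ℕ) :
    ∃ δ > 0, ∀ q : Fin m → X, ∃ u : List (Fin k), ∀ x j, dist (run f u x) (q j) < δ →
      Hit f I u x := by
  obtain ⟨δ, hδ, h⟩ := lebesgue_number_lemma_of_metric (isCompact_univ (X := Fin m → X))
    (c := fun u : List (Fin k) => Set.univ.pi fun _ => run f u '' {x | Hit f I u x})
    (fun u => isOpen_set_pi Set.finite_univ fun _ _ =>
      (run_homeo f hf u).isOpenMap _ (hit_open f I hf hI u)) (fun q _ => by
      obtain ⟨u, hu⟩ := bwd_kill hk hf hB hI hne (List.ofFn q)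
      exact Set.mem_iUnion.2 ⟨u, fun j _ => hu _ (by simp)⟩)
  refine ⟨δ, hδ, fun q => ?_⟩
  obtain ⟨u, hu⟩ := h q (Set.mem_univ q)
  refine ⟨u, fun x j hx => ?_⟩
  have : Function.update q j (run f u x) ∈ Metric.ball q δ := by
    rw [Metric.mem_ball, dist_pi_lt_iff hδ]
    intro l
    by_cases hl : l = j
    · subst hl; simpa using hx
    · simpa [Function.update_of_ne hl] using hδ
  obtain ⟨y, hy, hxy⟩ := hu this j (Set.mem_univ j)
  simp only [Function.update_self] at hxy
  exact (run_homeo f hf u).injective hxy ▸ hy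

lemma hit_fib {X : Type*} {k : ℕ} (f : Fin k → X → X) (I : Set X) (ω : ℕ → Fin k) (x : X)
    (w : List (Fin k)) (n : ℕ) (hw : ∀ j (h : j < w.length), ω (n + j) = w[j])
    (h : Hit f I w (FibIter f ω n x)) : ∃ m ≥ 1, FibIter f ω m x ∈ I := by
  induction w generalizing n with
  | nil => exact h.elim
  | cons i w ih =>
    have h0 : ω n = i := hw 0 (by simp)
    have e : f i (FibIter f ω n x) = FibIter f ω (n+1) x := by rw [← h0]; rfl
    rcases h with h | h
    · exact ⟨n+1, by omega, e ▸ h⟩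
    · refine ih (n+1) (fun j hj => ?_) (e ▸ h)
      have := hw (j+1) (by simpa using hj)
      rw [List.getElem_cons_succ] at this
      rw [← this]; congr 1; omega

lemma shift_apply {k : ℕ} (ω : ℕ → Fin k) (n m : ℕ) : shiftSeq^[n] ω m = ω (n + m) := by
  induction n generalizing ω with
  | zero => simp
  | succ n ih => rw [Function.iterate_succ_apply, ih]; simp [shiftSeq]; congr 1; omega

lemma disj_word {k : ℕ} (hk : 0 < k) {ω : ℕ → Fin k} (hω : Disjunctive ω) (w : List (Fin k)) :
    ∃ n, ∀ j (h : j < w.length), ω (n + j) = w[j] := by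
  let V : Set (ℕ → Fin k) := ⋂ j : Fin w.length, {η | η j = w[j]}
  have hV : IsOpen V := by
    refine isOpen_iInter_of_finite fun j => ?_
    have hc : Continuous fun η : ℕ → Fin k => η (j : ℕ) := continuous_apply _
    exact (isOpen_discrete ({w[j]} : Set (Fin k))).preimage hc
  obtain ⟨_, hη, n, rfl⟩ := hω.inter_open_nonempty V hV
    ⟨fun j => if h : j < w.length then w[j] else ⟨0, hk⟩, by simp [V]⟩
  refine ⟨n, fun j h => ?_⟩
  have := Set.mem_iInter.1 hη ⟨j, h⟩
  simpa [shift_apply] using this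

lemma exists_disj {k : ℕ} (hk : 0 < k) : ∃ ω : ℕ → Fin k, Disjunctive ω := by
  let ω : ℕ → Fin k := fun m =>
    ((Encodable.decode (α := List (Fin k)) (Nat.unpair (Nat.log 2 m)).2).getD []).getD
      (m - 2 ^ (Nat.log 2 m)) ⟨0, hk⟩
  refine ⟨ω, ?_⟩
  rw [Disjunctive, dense_iff_inter_open]
  rintro U hU ⟨η, hη⟩
  obtain ⟨s, u, h1, h2⟩ := isOpen_pi_iff.1 hU η hη
  let N := s.sup id + 1
  let w : List (Fin k) := List.ofFn fun j : Fin N => η j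
  let a := Nat.pair N (Encodable.encode w)
  refine ⟨_, h2 ?_, 2 ^ a, rfl⟩
  intro j hj
  have hjN : j < N := Nat.lt_succ_of_le (Finset.le_sup (f := id) hj)
  have hja : j < 2 ^ a := hjN.trans_le ((Nat.left_le_pair _ _).trans Nat.lt_two_pow_self.le)
  have hlog : Nat.log 2 (2 ^ a + j) = a := by
    rw [Nat.log_eq_iff (by right; constructor <;> omega)]
    constructor
    · omega
    · rw [pow_succ]; omega
  have : shiftSeq^[2 ^ a] ω j = η j := by
    rw [shift_apply]
    simp only [ω, hlog]
    have hwj : w.getD j ⟨0, hk⟩ = η j := by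
      have hl : j < w.length := by rw [List.length_ofFn]; exact hjN
      rw [List.getD_eq_getElem _ _ hl, List.getElem_ofFn]
    have e1 : (Nat.unpair a).2 = Encodable.encode w := by simp only [a, Nat.unpair_pair]
    rw [e1, Encodable.encodek, Nat.add_sub_cancel_left]
    exact hwj
  simp only [this]
  exact (h1 j hj).2

lemma dist_exp_le (s t : ℝ) : dist (Circle.exp s) (Circle.exp t) ≤ |s - t| := by
  have h1 : dist (Circle.exp s) (Circle.exp t) = ‖(Circle.exp s : ℂ) - Circle.exp t‖ := by
    rw [← dist_eq_norm]; rfl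
  have h2 : (Circle.exp s : ℂ) - Circle.exp t
      = (Circle.exp t : ℂ) * (Complex.exp (Complex.I * ((s - t : ℝ) : ℂ)) - 1) := by
    rw [mul_sub, mul_one, Circle.coe_exp, Circle.coe_exp, ← Complex.exp_add]
    congr 2
    push_cast; ring
  rw [h1, h2, norm_mul, Circle.norm_coe, one_mul]
  exact Real.norm_exp_I_mul_ofReal_sub_one_le

lemma dist_mul_circle (a x y : Circle) : dist (a * x) (a * y) = dist x y := by
  have h : ∀ x y : Circle, dist x y = ‖(x : ℂ) - y‖ := fun x y => by
    rw [← dist_eq_norm]; rfl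
  rw [h, h, Circle.coe_mul, Circle.coe_mul, ← mul_sub, norm_mul, Circle.norm_coe, one_mul]

lemma circ_conn {r : ℝ} (hr : 0 < r) : ∃ ρ > 0, ∀ J : Set Circle, IsPreconnected J →
    (∀ z, ¬ Metric.ball z ρ ⊆ J) → ∀ x ∈ J, ∀ y ∈ J, dist y x < r := by
  have hE : IsOpenMap Circle.exp := isLocalHomeomorph_circleExp.isOpenMap
  set δ := r / 4 with hδ
  have hδ0 : 0 < δ := by positivity
  obtain ⟨ρ, hρ, hball⟩ := Metric.isOpen_iff.1 (hE _ (isOpen_Ioo (a := -δ) (b := δ))) 1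
    ⟨0, by constructor <;> linarith, Circle.exp_zero⟩
  have hb : ∀ c : ℝ, Metric.ball (Circle.exp c) ρ ⊆ Circle.exp '' Ioo (c - δ) (c + δ) := by
    intro c z hz
    have : (Circle.exp c)⁻¹ * z ∈ Metric.ball (1 : Circle) ρ := by
      rw [Metric.mem_ball, ← dist_mul_circle (Circle.exp c)]
      simpa using hz
    obtain ⟨s, hs, hsz⟩ := hball this
    refine ⟨c + s, ⟨by linarith [hs.1], by linarith [hs.2]⟩, ?_⟩
    rw [Circle.exp_add, hsz]; simp
  refine ⟨ρ, hρ, fun J hJ hno x hx y hy => ?_⟩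
  obtain ⟨t, rfl⟩ := Circle.exp_surjective x
  have key : ∀ c : ℝ, ∃ p ∈ Ioo (c - δ) (c + δ), Circle.exp p ∉ J := by
    intro c
    by_contra hcon
    push Not at hcon
    refine hno (Circle.exp c) ((hb c).trans ?_)
    rintro _ ⟨p, hp, rfl⟩
    exact hcon p hp
  obtain ⟨p, hp, hpJ⟩ := key (t - δ)
  obtain ⟨q, hq, hqJ⟩ := key (t + δ)
  have hsub : J ⊆ Circle.exp '' Ioo p q ∪ (Circle.exp '' Icc p q)ᶜ := by
    intro z hz
    by_cases h : z ∈ Circle.exp '' Icc p q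
    · left
      obtain ⟨s, hs, rfl⟩ := h
      refine ⟨s, ⟨lt_of_le_of_ne hs.1 ?_, lt_of_le_of_ne hs.2 ?_⟩, rfl⟩
      · rintro rfl; exact hpJ hz
      · rintro rfl; exact hqJ hz
    · exact Or.inr h
  have hcl : IsClosed (Circle.exp '' Icc p q) :=
    (isCompact_Icc.image (map_continuous Circle.exp)).isClosed
  have := hJ.subset_left_of_subset_union (hE _ isOpen_Ioo) hcl.isOpen_compl
    (Set.disjoint_compl_right_iff_subset.2 (Set.image_mono Ioo_subset_Icc_self)) hsub
    ⟨Circle.exp t, hx, t, ⟨by linarith [hp.2], by linarith [hq.1]⟩, rfl⟩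
  obtain ⟨s, hs, rfl⟩ := this hy
  refine (dist_exp_le s t).trans_lt ?_
  rw [abs_lt]
  constructor <;> linarith [hs.1, hs.2, hp.1, hq.2]

open Real in
/-- The pieces of the standard partition of the circle into `n` half-open arcs. -/
noncomputable def piece (n : ℕ) (j : Fin n) : Set Circle :=
  Circle.exp '' Ico (2 * π * j / n) (2 * π * (j + 1) / n)

open Real in
lemma piece_sub {n : ℕ} (j : Fin n) : Ico (2 * π * j / n) (2 * π * (j + 1) / n) ⊆ Ico 0 (2 * π) := by
  have hn : (0:ℝ) < n := by exact_mod_cast (Fin.pos j)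
  have hj : (j : ℝ) + 1 ≤ n := by exact_mod_cast j.2
  apply Ico_subset_Ico
  · positivity
  · rw [div_le_iff₀ hn]; nlinarith [Real.pi_pos]

lemma piece_disj (n : ℕ) : Pairwise (Function.onFun Disjoint (piece n)) := by
  have main : ∀ i j : Fin n, i < j → Disjoint (piece n i) (piece n j) := by
    intro i j hij
    rw [Set.disjoint_left]
    rintro _ ⟨s, hs, rfl⟩ ⟨t, ht, hst⟩
    have := Circle.exp_injOn_Ico (a := 0) (b := 2 * Real.pi) (by simp) (piece_sub j ht)
      (piece_sub i hs) hst
    subst this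
    have h1 : ((i : ℕ) : ℝ) + 1 ≤ j := by exact_mod_cast hij
    have hn : (0:ℝ) < n := by exact_mod_cast (Fin.pos j)
    have : 2 * Real.pi * ((i:ℕ) + 1) / n ≤ 2 * Real.pi * (j : ℕ) / n := by gcongr
    linarith [hs.2, ht.1]
  intro i j hij
  rcases lt_or_gt_of_ne hij with h | h
  · exact main i j h
  · exact (main j i h).symm

open Real in
lemma piece_cover {n : ℕ} (hn : 0 < n) (x : Circle) : ∃ j, x ∈ piece n j := by
  have hn' : (0:ℝ) < n := by exact_mod_cast hn
  have h2π : (0:ℝ) < 2 * π := by positivity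
  obtain ⟨t, rfl⟩ := Circle.exp_surjective x
  obtain ⟨s, hs, hst⟩ := Circle.periodic_exp.exists_mem_Ico₀ h2π t
  have h0 : 0 ≤ s * n / (2 * π) := div_nonneg (mul_nonneg hs.1 hn'.le) h2π.le
  have hlt : ⌊s * n / (2 * π)⌋₊ < n := by
    rw [Nat.floor_lt h0, div_lt_iff₀ h2π]; nlinarith [hs.2]
  refine ⟨⟨_, hlt⟩, s, ⟨?_, ?_⟩, hst.symm⟩
  · have := Nat.floor_le h0
    rw [le_div_iff₀ h2π] at this
    rw [div_le_iff₀ hn']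
    simp only; linarith
  · have := Nat.lt_floor_add_one (s * n / (2 * π))
    rw [div_lt_iff₀ h2π] at this
    rw [lt_div_iff₀ hn']
    simp only; linarith

open Real in
lemma piece_dist {n : ℕ} (j : Fin n) {x : Circle} (hx : x ∈ piece n j) :
    dist x (Circle.exp (2 * π * j / n)) ≤ 2 * π / n := by
  obtain ⟨s, hs, rfl⟩ := hx
  refine (dist_exp_le _ _).trans ?_
  have : 2 * π * (j + 1) / n = 2 * π * j / n + 2 * π / n := by ring
  rw [abs_of_nonneg (by linarith [hs.1])]
  linarith [hs.2]

lemma master {k : ℕ} (hk : 0 < k) {f : Fin k → Circle → Circle}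
    (hf : ∀ i, IsHomeomorph (f i)) (hF : ForwardMinimal f) (hB : BackwardMinimal f)
    {I : Set Circle} (hI : IsOpen I) (hne : I.Nonempty) : ∃ w, ∀ x, Hit f I w x := by
  obtain ⟨L, hG, hLs⟩ := exists_lam hk f (fun i => (hf i).bijective) 1
  obtain ⟨r, hr, M, hM⟩ := uniform_hit hk hf hF hI hne
  obtain ⟨ρ, hρ, hconn⟩ := circ_conn hr
  obtain ⟨ε, hε, hball⟩ := lam_ball hf hB hG hLs hρ
  have hkill : ∀ J, IsPreconnected J → L J < ε →
      ∃ v : List (Fin k), v.length ≤ M ∧ ∀ x ∈ J, Hit f I v x := by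
    intro J hJ hlt
    rcases J.eq_empty_or_nonempty with rfl | ⟨x, hx⟩
    · exact ⟨[], by simp, by simp⟩
    obtain ⟨w, hw, h⟩ := hM x
    refine ⟨w, hw, fun y hy => h y (hconn J hJ (fun z hz => ?_) x hx y hy)⟩
    linarith [hball z, hG.mono hz]
  let m := ⌊2 / ε⌋₊
  obtain ⟨δ, hδ, hu⟩ := bwd_uniform hk hf hB hI hne m
  obtain ⟨n, hn⟩ := exists_nat_gt (2 * Real.pi / δ)
  have hn' : (0:ℝ) < n := lt_trans (by positivity) hn
  have hnδ : 2 * Real.pi / n < δ := by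
    rw [div_lt_iff₀ hδ] at hn
    rw [div_lt_iff₀ hn']; linarith
  obtain ⟨w, S, -, hS, hw⟩ := count hk f I IsPreconnected
    (fun A i hA => hA.image _ (hf i).continuous.continuousOn) L hG.nonneg hLs ε M hkill 2 n
    Finset.univ (piece n) (by simp)
    (fun j => isPreconnected_Ico.image _ (map_continuous Circle.exp).continuousOn)
    (by rw [hG.sum_eq _ _ (piece_disj n)]; linarith [hG.le_one (⋃ i ∈ Finset.univ, piece n i)])
  have hSm : S.card ≤ m := Nat.le_floor (by rw [le_div_iff₀' hε]; exact hS)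
  obtain ⟨u, hu⟩ := hu fun l => if h : (l : ℕ) < S.card then
    Circle.exp (2 * Real.pi * ((S.equivFin.symm ⟨l, h⟩ : S) : Fin n) / n) else 1
  refine ⟨u ++ w, fun x => (hit_append _ _ _ _ _).2 ?_⟩
  obtain ⟨j, hj⟩ := piece_cover (by exact_mod_cast hn') (run f u x)
  by_cases hjS : j ∈ S
  · left
    refine hu x ⟨S.equivFin ⟨j, hjS⟩, (Fin.is_lt _).trans_le hSm⟩ ?_
    simpa using (piece_dist j hj).trans_lt hnδ
  · exact Or.inr (hw j (Finset.mem_univ j) hjS _ hj)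

lemma iii_ii {k : ℕ} (hk : 0 < k) {f : Fin k → Circle → Circle}
    (hf : ∀ i, IsHomeomorph (f i)) (hF : ForwardMinimal f) (hB : BackwardMinimal f)
    (ω : ℕ → Fin k) (hω : Disjunctive ω) (x : Circle) : Dense (Oplus f ω x) := by
  rw [dense_iff_inter_open]
  intro I hI hne
  obtain ⟨w, hw⟩ := master hk hf hF hB hI hne
  obtain ⟨n, hn⟩ := disj_word hk hω w
  obtain ⟨m, hm, h⟩ := hit_fib f I ω x w n hn (hw _)
  exact ⟨_, h, m, hm, rfl⟩

lemma single_mem {X : Type*} {k : ℕ} (f : Fin k → X → X) (i : Fin k) : f i ∈ IFSsemigroup f :=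
  ⟨[i], by simp, by simp⟩

lemma i_fwd {k : ℕ} {f : Fin k → Circle → Circle} {ω : ℕ → Fin k}
    (h : ∀ x : Circle, Dense (Oplus f ω x)) : ForwardMinimal f := by
  rintro B ⟨x, hx⟩ hcl hB
  have : ∀ n, FibIter f ω n x ∈ B := by
    intro n
    induction n with
    | zero => exact hx
    | succ n ih => exact hB _ ⟨_, ih, rfl⟩
  have hd := (h x).mono (s₂ := B) (by rintro _ ⟨m, -, rfl⟩; exact this m)
  rw [← hcl.closure_eq]; exact hd.closure_eq

lemma i_bwd {k : ℕ} {f : Fin k → Circle → Circle} (hf : ∀ i, IsHomeomorph (f i))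
    {ω : ℕ → Fin k} (h : ∀ x : Circle, Dense (Oplus f ω x)) : BackwardMinimal f := by
  rintro B hne hcl hB
  have hFc : ∀ n, Continuous (FibIter f ω n) := by
    intro n
    induction n with
    | zero => exact continuous_id
    | succ n ih => exact (hf _).continuous.comp ih
  have hFs : ∀ n, Function.Surjective (FibIter f ω n) := by
    intro n
    induction n with
    | zero => exact Function.surjective_id
    | succ n ih => exact (hf _).surjective.comp ih
  obtain ⟨x, hx⟩ := IsCompact.nonempty_iInter_of_sequence_nonempty_isCompact_isClosed
    (fun n => FibIter f ω n ⁻¹' B)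
    (fun n x hx => (hB _ (single_mem f (ω n))).2 hx)
    (fun n => hne.preimage (hFs n)) (hcl.preimage (hFc 0)).isCompact
    (fun n => hcl.preimage (hFc n))
  have hd := (h x).mono (s₂ := B) (by rintro _ ⟨m, -, rfl⟩; exact Set.mem_iInter.1 hx m)
  rw [← hcl.closure_eq]; exact hd.closure_eq

end CG

theorem circle_deterministic_chaos_game_iff_forward_backward_minimal
    {k : ℕ} (hk : 0 < k)
    (f : Fin k → Circle → Circle) (hf : ∀ i, IsHomeomorph (f i)) :
    ((∃ ω : ℕ → Fin k, ∀ x : Circle, Dense (Oplus f ω x)) ↔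
      (∀ ω : ℕ → Fin k, Disjunctive ω → ∀ x : Circle, Dense (Oplus f ω x))) ∧
    ((∃ ω : ℕ → Fin k, ∀ x : Circle, Dense (Oplus f ω x)) ↔
      (ForwardMinimal f ∧ BackwardMinimal f)) := by
  have h13 : (∃ ω : ℕ → Fin k, ∀ x : Circle, Dense (Oplus f ω x)) →
      (ForwardMinimal f ∧ BackwardMinimal f) :=
    fun ⟨_, h⟩ => ⟨CG.i_fwd h, CG.i_bwd hf h⟩
  have h32 : (ForwardMinimal f ∧ BackwardMinimal f) →
      (∀ ω : ℕ → Fin k, Disjunctive ω → ∀ x : Circle, Dense (Oplus f ω x)) :=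
    fun h ω hω x => CG.iii_ii hk hf h.1 h.2 ω hω x
  have h21 : (∀ ω : ℕ → Fin k, Disjunctive ω → ∀ x : Circle, Dense (Oplus f ω x)) →
      (∃ ω : ℕ → Fin k, ∀ x : Circle, Dense (Oplus f ω x)) := fun h => by
    obtain ⟨ω, hω⟩ := CG.exists_disj hk
    exact ⟨ω, h ω hω⟩
  exact ⟨⟨fun h => h32 (h13 h), h21⟩, ⟨h13, fun h => h21 (h32 h)⟩⟩
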